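/- In U_q[gl(m|n)], for indices with a < c < b < d, the graded commutator satisfies [E^b_a, E^c_d] = −Δ_c E^b_d E^c_a K_c^{-1} K_b. -/

import Mathlib

/-!
U_q[gl(m|n)]: the quantum superalgebra presented by generators and relations,
following Zhang (1993).  We work over the field ℚ(q) of rational functions.
-/

noncomputable section

/-- The base field ℚ(q) of rational functions in the indeterminate q. -/
abbrev Fq : Type := RatFunc ℚ

/-- The indeterminate q. -/
def qq : Fq := RatFunc.X

/-- The ℤ₂-grading of an index: `[a] = 0` if `a ≤ m`, `[a] = 1` if `a > m`. -/
def gr (m a : ℕ) : ℕ := if a ≤ m then 0 else 1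

/-- `q_a = q^{(-1)^{[a]}}`. -/
def qi (m a : ℕ) : Fq := if a ≤ m then qq else qq⁻¹

/-- `Δ = q - q⁻¹`. -/
def Δq : Fq := qq - qq⁻¹

/-- `Δ_a = (-1)^{[a]} Δ`. -/
def Δi (m a : ℕ) : Fq := (-1 : Fq) ^ gr m a * Δq

/-- Kronecker delta, as an integer. -/
def δℤ (a b : ℕ) : ℤ := if a = b then 1 else 0

/-- The sign `(-1)^{[E^a_b][E^c_d]}`, where `[E^a_b] = [a] + [b] (mod 2)`. -/
def sgn (m a b c d : ℕ) : Fq := (-1 : Fq) ^ ((gr m a + gr m b) * (gr m c + gr m d))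

/-- The quantum superalgebra `U_q[gl(m|n)]`: a unital associative ℚ(q)-algebra with
invertible Cartan generators `K a` (`1 ≤ a ≤ m+n`) and generators `E a b`
(simple ones for `|a-b| = 1`, nonsimple ones defined recursively for `|a-b| > 1`),
subject to the defining relations below. -/
structure UqGl (m n : ℕ) where
  /-- the underlying carrier -/
  A : Type
  ringA : Ring A
  algA : Algebra Fq A
  /-- Cartan generators `K_a` -/
  K : ℕ → A
  /-- inverse Cartan generators `K_a⁻¹` -/
  Kinv : ℕ → A
  /-- generators `E^a_b` -/
  E : ℕ → ℕ → A
  /-- (i) the Cartan generators commute -/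
  K_comm : ∀ a b, 1 ≤ a → a ≤ m + n → 1 ≤ b → b ≤ m + n →
    K a * K b = K b * K a
  /-- (i) `K_a K_a⁻¹ = 1` -/
  K_Kinv : ∀ a, 1 ≤ a → a ≤ m + n → K a * Kinv a = 1
  /-- (i) `K_a⁻¹ K_a = 1` -/
  Kinv_K : ∀ a, 1 ≤ a → a ≤ m + n → Kinv a * K a = 1
  /-- (ii) `K_a E^b_{b+1} = q_a^{δ^a_b - δ^a_{b+1}} E^b_{b+1} K_a` -/
  K_E_raise : ∀ a b, 1 ≤ a → a ≤ m + n → 1 ≤ b → b + 1 ≤ m + n →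
    K a * E b (b+1) = (qi m a ^ (δℤ a b - δℤ a (b+1))) • (E b (b+1) * K a)
  /-- (ii) `K_a E^{b+1}_b = q_a^{δ^a_{b+1} - δ^a_b} E^{b+1}_b K_a` -/
  K_E_lower : ∀ a b, 1 ≤ a → a ≤ m + n → 1 ≤ b → b + 1 ≤ m + n →
    K a * E (b+1) b = (qi m a ^ (δℤ a (b+1) - δℤ a b)) • (E (b+1) b * K a)
  /-- (iii) `[E^a_{a+1}, E^{b+1}_b] = δ^a_b Δ_a⁻¹ (K_a K_{a+1}⁻¹ - K_a⁻¹ K_{a+1})` -/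
  EF_rel : ∀ a b, 1 ≤ a → a + 1 ≤ m + n → 1 ≤ b → b + 1 ≤ m + n →
    E a (a+1) * E (b+1) b - sgn m a (a+1) (b+1) b • (E (b+1) b * E a (a+1)) =
      (if a = b then (Δi m a)⁻¹ else 0) • (K a * Kinv (a+1) - Kinv a * K (a+1))
  /-- (iv) simple lowering generators commute when `|a-b| > 1` -/
  EE_lower : ∀ a b, 1 ≤ a → a + 1 ≤ m + n → 1 ≤ b → b + 1 ≤ m + n →
    (a + 1 < b ∨ b + 1 < a) →
    E (a+1) a * E (b+1) b = E (b+1) b * E (a+1) a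
  /-- (iv) simple raising generators commute when `|a-b| > 1` -/
  EE_raise : ∀ a b, 1 ≤ a → a + 1 ≤ m + n → 1 ≤ b → b + 1 ≤ m + n →
    (a + 1 < b ∨ b + 1 < a) →
    E a (a+1) * E b (b+1) = E b (b+1) * E a (a+1)
  /-- (v) the square of the odd simple raising generator is zero -/
  odd_raise_sq : E m (m+1) * E m (m+1) = 0
  /-- (v) the square of the odd simple lowering generator is zero -/
  odd_lower_sq : E (m+1) m * E (m+1) m = 0
  /-- (vi) Serre relation `E^{a+1}_a E^{a+2}_a = q_a E^{a+2}_a E^{a+1}_a`, `a ≠ m` -/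
  serre1 : m ≠ 1 → n ≠ 1 → ∀ a, 1 ≤ a → a + 2 ≤ m + n → a ≠ m →
    E (a+1) a * E (a+2) a = qi m a • (E (a+2) a * E (a+1) a)
  /-- (vi) Serre relation `E^a_{a+1} E^a_{a+2} = q_a E^a_{a+2} E^a_{a+1}`, `a ≠ m` -/
  serre2 : m ≠ 1 → n ≠ 1 → ∀ a, 1 ≤ a → a + 2 ≤ m + n → a ≠ m →
    E a (a+1) * E a (a+2) = qi m a • (E a (a+2) * E a (a+1))
  /-- (vi) Serre relation `E^{a+1}_{a-1} E^{a+1}_a = q_a E^{a+1}_a E^{a+1}_{a-1}`, `a ≠ m` -/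
  serre3 : m ≠ 1 → n ≠ 1 → ∀ a, 2 ≤ a → a + 1 ≤ m + n → a ≠ m →
    E (a+1) (a-1) * E (a+1) a = qi m a • (E (a+1) a * E (a+1) (a-1))
  /-- (vi) Serre relation `E^{a-1}_{a+1} E^a_{a+1} = q_a E^a_{a+1} E^{a-1}_{a+1}`, `a ≠ m` -/
  serre4 : m ≠ 1 → n ≠ 1 → ∀ a, 2 ≤ a → a + 1 ≤ m + n → a ≠ m →
    E (a-1) (a+1) * E a (a+1) = qi m a • (E a (a+1) * E (a-1) (a+1))
  /-- (vi) Serre relation `[E^{m+1}_m, E^{m+2}_{m-1}] = 0` -/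
  serre5 : m ≠ 1 → n ≠ 1 →
    E (m+1) m * E (m+2) (m-1) -
      sgn m (m+1) m (m+2) (m-1) • (E (m+2) (m-1) * E (m+1) m) = 0
  /-- (vi) Serre relation `[E^m_{m+1}, E^{m-1}_{m+2}] = 0` -/
  serre6 : m ≠ 1 → n ≠ 1 →
    E m (m+1) * E (m-1) (m+2) -
      sgn m m (m+1) (m-1) (m+2) • (E (m-1) (m+2) * E m (m+1)) = 0
  /-- the nonsimple generators: for any `c` strictly between `a` and `b`,
  `E^a_b = E^a_c E^c_b - q_c^{sign(a-b)} E^c_b E^a_c` -/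
  nonsimple_def : ∀ a b c, 1 ≤ a → a ≤ m + n → 1 ≤ b → b ≤ m + n →
    ((a < c ∧ c < b) ∨ (b < c ∧ c < a)) →
    E a b = E a c * E c b - (if b < a then qi m c else (qi m c)⁻¹) • (E c b * E a c)

attribute [instance] UqGl.ringA UqGl.algA

namespace UqGl

variable {m n : ℕ}

/-- The graded commutator `[E^a_b, E^c_d] = E^a_b E^c_d - (-1)^{[E^a_b][E^c_d]} E^c_d E^a_b`. -/
def br (U : UqGl m n) (a b c d : ℕ) : U.A :=
  U.E a b * U.E c d - sgn m a b c d • (U.E c d * U.E a b)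

end UqGl

section Abstract
variable {k A : Type*} [Field k] [Ring A] [Algebra k A]

/-- `[PR - qRP, Q]` when `R, Q` commute. -/
theorem abs_B (P Q R h h' : A) (s t q : k)
    (hRQ : R * Q = Q * R) (hPQ : P * Q - s • (Q * P) = t • (h - h'))
    (hh : h * R = q • (R * h)) (hh' : h' * R = q⁻¹ • (R * h')) :
    (P * R - q • (R * P)) * Q - s • (Q * (P * R - q • (R * P)))
      = (t * (q - q⁻¹)) • (R * h') := by
  have e1 : P * Q = s • (Q * P) + t • (h - h') := by rw [← hPQ]; abel
  have e2 : P * (R * Q) = s • (Q * (P * R)) + t • (q • (R * h) - q⁻¹ • (R * h')) := by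
    rw [hRQ, ← mul_assoc, e1, add_mul, smul_mul_assoc, smul_mul_assoc, sub_mul, hh, hh',
      mul_assoc]
  have e3 : R * (P * Q) = s • (Q * (R * P)) + t • (R * h - R * h') := by
    rw [e1, mul_add, mul_smul_comm, mul_smul_comm, mul_sub, ← mul_assoc R Q P, hRQ, mul_assoc]
  simp only [sub_mul, mul_sub, smul_mul_assoc, mul_smul_comm, mul_assoc, e2, e3]
  module

/-- `[PR - qRP, X]` when `P, X` commute. -/
theorem abs_A (P R X h h' : A) (s t q : k) (hq : q ≠ 0)
    (hPX : P * X = X * P) (hRX : R * X - s • (X * R) = t • (h - h'))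
    (hh : h * P = q • (P * h)) (hh' : h' * P = q⁻¹ • (P * h')) :
    (P * R - q • (R * P)) * X - s • (X * (P * R - q • (R * P)))
      = (t * (1 - q * q)) • (P * h) := by
  have e1 : R * X = s • (X * R) + t • (h - h') := by rw [← hRX]; abel
  have e2 : R * (P * X) = s • (X * (R * P)) + t • (q • (P * h) - q⁻¹ • (P * h')) := by
    rw [hPX, ← mul_assoc, e1, add_mul, smul_mul_assoc, smul_mul_assoc, sub_mul, hh, hh',
      mul_assoc]
  have e3 : P * (R * X) = s • (X * (P * R)) + t • (P * h - P * h') := by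
    rw [e1, mul_add, mul_smul_comm, mul_smul_comm, mul_sub, ← mul_assoc P X R, hPX, mul_assoc]
  simp only [sub_mul, mul_sub, smul_mul_assoc, mul_smul_comm, mul_assoc, e2, e3]
  match_scalars <;> field_simp <;> ring

/-- final step. -/
theorem abs_C (W Q Y R h' : A) (s κ q : k)
    (hWY : W * Y = Y * W) (hWQ : W * Q - s • (Q * W) = κ • (R * h'))
    (hh' : h' * Y = q • (Y * h')) (hRY : R * Y = Y * R) :
    W * (Q * Y - q⁻¹ • (Y * Q)) - s • ((Q * Y - q⁻¹ • (Y * Q)) * W)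
      = (κ * (q - q⁻¹)) • (Y * R * h') := by
  have e1 : W * Q = s • (Q * W) + κ • (R * h') := by rw [← hWQ]; abel
  have e2 : W * (Q * Y) = s • (Q * (Y * W)) + (κ * q) • (Y * (R * h')) := by
    rw [← mul_assoc, e1, add_mul, smul_mul_assoc, smul_mul_assoc, mul_assoc, mul_assoc, hh', hWY,
      mul_smul_comm, ← mul_assoc R, hRY, mul_assoc, smul_smul]
  have e3 : W * (Y * Q) = s • (Y * (Q * W)) + κ • (Y * (R * h')) := by
    rw [← mul_assoc, hWY, mul_assoc, e1, mul_add, mul_smul_comm, mul_smul_comm]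
  simp only [sub_mul, mul_sub, smul_mul_assoc, mul_smul_comm, mul_assoc, e2, e3]
  module

/-- induction step for the commutator `[E^b_c, E^c_b]`. -/
theorem abs_step (W X Y X' Y' h h' g g' H H' : A) (s1 s2 d1 d2 q : k) (hq : q ≠ 0)
    (hs1 : s1 * s1 = 1) (hs2 : s2 * s2 = 1) (hd2 : d2 ≠ 0) (hqd : q - q⁻¹ = d2)
    (hWX : W * X - s1 • (X * W) = (-s1 * d1⁻¹ * (1 - q * q)) • (Y' * h))
    (hWY : W * Y - s2 • (Y * W) = (-s2) • (X' * g'))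
    (hXX : X' * X - s1 • (X * X') = (-s1 * d1⁻¹) • (h - h'))
    (hYY : Y' * Y - s2 • (Y * Y') = (-s2 * d2⁻¹) • (g - g'))
    (hhY : h * Y = q⁻¹ • (Y * h)) (hgX : g' * X = q • (X * g'))
    (hH : g * h = H) (hH' : h' * g' = H') (hc : g' * h = h * g') :
    W * (X * Y - q⁻¹ • (Y * X)) - (s1 * s2) • ((X * Y - q⁻¹ • (Y * X)) * W)
      = (-(s1 * s2) * d1⁻¹) • (H - H') := by
  have hd : -s1 * d1⁻¹ * (1 - q * q) = s1 * d1⁻¹ * d2 * q := by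
    rw [← hqd]; field_simp; ring
  rw [hd] at hWX
  have e1 : W * X = s1 • (X * W) + (s1 * d1⁻¹ * d2 * q) • (Y' * h) := by
    rw [← hWX]; abel
  have e2 : W * Y = s2 • (Y * W) + (-s2) • (X' * g') := by rw [← hWY]; abel
  have e3 : X' * X = s1 • (X * X') + (-s1 * d1⁻¹) • (h - h') := by rw [← hXX]; abel
  have e4 : Y' * Y = s2 • (Y * Y') + (-s2 * d2⁻¹) • (g - g') := by rw [← hYY]; abel
  have f1 : W * (X * Y) = (s1 * s2) • (X * (Y * W)) + (-(s1 * s2)) • (X * (X' * g'))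
      + (s1 * d1⁻¹ * d2 * q * q⁻¹) •
        (s2 • (Y * (Y' * h)) + (-s2 * d2⁻¹) • (H - h * g')) := by
    rw [← mul_assoc, e1, add_mul, smul_mul_assoc, smul_mul_assoc, mul_assoc X, mul_assoc Y', hhY, e2,
      mul_smul_comm, ← mul_assoc Y', e4, ← hH, ← hc]
    simp only [add_mul, mul_add, sub_mul, smul_mul_assoc, mul_smul_comm, mul_assoc]
    module
  have f2 : W * (Y * X) = (s1 * s2) • (Y * (X * W))
      + (s2 * (s1 * d1⁻¹ * d2 * q)) • (Y * (Y' * h))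
      + (-s2 * q) • (s1 • (X * (X' * g')) + (-s1 * d1⁻¹) • (h * g' - H')) := by
    rw [← mul_assoc, e2, add_mul, smul_mul_assoc, smul_mul_assoc, mul_assoc Y, mul_assoc X', hgX, e1,
      mul_smul_comm, ← mul_assoc X', e3, ← hH']
    simp only [add_mul, mul_add, sub_mul, smul_mul_assoc, mul_smul_comm, mul_assoc]
    module
  simp only [sub_mul, mul_sub, smul_mul_assoc, mul_smul_comm, mul_assoc, f1, f2]
  match_scalars <;> field_simp <;> ring

theorem commute_inv_aux (x y z : A) (h1 : x * y = 1) (h2 : y * x = 1) (h : Commute x z) :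
    Commute y z := by
  have : y * z = z * y := by
    calc y * z = y * z * (x * y) := by rw [h1, mul_one]
      _ = y * (z * x) * y := by simp only [mul_assoc]
      _ = y * (x * z) * y := by rw [h.eq]
      _ = (y * x) * z * y := by simp only [mul_assoc]
      _ = z * y := by rw [h2, one_mul]
  exact this

theorem inv_scale_aux (x y z : A) (q : k) (hq : q ≠ 0) (h1 : x * y = 1) (h2 : y * x = 1)
    (h : x * z = q • (z * x)) : y * z = q⁻¹ • (z * y) := by
  have e : z = q • (y * z * x) := by
    calc z = y * (x * z) := by rw [← mul_assoc, h2, one_mul]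
      _ = q • (y * z * x) := by rw [h, mul_smul_comm, mul_assoc]
  have e2 : z * y = q • (y * z) := by
    conv_lhs => rw [e]
    rw [smul_mul_assoc, mul_assoc, h1, mul_one]
  rw [e2, smul_smul, inv_mul_cancel₀ hq, one_smul]

end Abstract

theorem qq_ne : qq ≠ 0 := RatFunc.X_ne_zero

theorem qi_ne (m a : ℕ) : qi m a ≠ 0 := by
  unfold qi; split_ifs
  · exact qq_ne
  · exact inv_ne_zero qq_ne

theorem Δq_ne : Δq ≠ 0 := by
  intro h
  unfold Δq at h
  have h2 : qq * qq = 1 := by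
    have h0 := qq_ne
    have : qq = qq⁻¹ := sub_eq_zero.mp h
    nth_rewrite 2 [this]
    exact mul_inv_cancel₀ h0
  have h3 : (Polynomial.X * Polynomial.X : Polynomial ℚ) = 1 := by
    apply RatFunc.algebraMap_injective ℚ
    rw [map_mul, RatFunc.algebraMap_X, map_one]
    exact h2
  have := congrArg (Polynomial.eval 2) h3
  norm_num at this

theorem qi_sub (m a : ℕ) : qi m a - (qi m a)⁻¹ = Δi m a := by
  unfold qi Δi gr Δq; split_ifs <;> simp

theorem Δi_ne (m a : ℕ) : Δi m a ≠ 0 := by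
  unfold Δi
  exact mul_ne_zero (pow_ne_zero _ (by norm_num)) Δq_ne

/-- the sign `(-1)^{[a]+[b]}` -/
def sg (m a b : ℕ) : Fq := (-1) ^ (gr m a + gr m b)

theorem sg_sq (m a b : ℕ) : sg m a b * sg m a b = 1 := by
  unfold sg; rw [← mul_pow]; norm_num

theorem sg_comp (m a b c : ℕ) : sg m a b * sg m b c = sg m a c := by
  unfold sg gr; split_ifs <;> norm_num

namespace UqGl
variable {m n : ℕ} (U : UqGl m n)

theorem raise_def (a b c : ℕ) (h1 : 1 ≤ a) (h2 : a < c) (h3 : c < b) (h4 : b ≤ m + n) :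
    U.E a b = U.E a c * U.E c b - (qi m c)⁻¹ • (U.E c b * U.E a c) := by
  have := U.nonsimple_def a b c h1 (by omega) (by omega) h4 (Or.inl ⟨h2, h3⟩)
  rwa [if_neg (by omega)] at this

theorem lower_def (a b c : ℕ) (h1 : 1 ≤ b) (h2 : b < c) (h3 : c < a) (h4 : a ≤ m + n) :
    U.E a b = U.E a c * U.E c b - qi m c • (U.E c b * U.E a c) := by
  have := U.nonsimple_def a b c (by omega) h4 h1 (by omega) (Or.inr ⟨h2, h3⟩)
  rwa [if_pos (by omega)] at this

theorem commute_raise (z : U.A) (a b : ℕ) (h1 : 1 ≤ a) (hab : a < b) (h4 : b ≤ m + n)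
    (hz : ∀ i, a ≤ i → i < b → Commute z (U.E i (i+1))) : Commute z (U.E a b) := by
  induction b, hab using Nat.le_induction with
  | base => exact hz a le_rfl (by omega)
  | succ b hb ih =>
    have i1 := ih (by omega) (fun i hi hi' => hz i hi (by omega))
    have i2 := hz b (by omega) (by omega)
    rw [U.raise_def a (b+1) b h1 hb (by omega) h4]
    exact (i1.mul_right i2).sub_right ((i2.mul_right i1).smul_right _)

theorem commute_lower (z : U.A) (a b : ℕ) (h1 : 1 ≤ a) (hab : a < b) (h4 : b ≤ m + n)
    (hz : ∀ i, a ≤ i → i < b → Commute z (U.E (i+1) i)) : Commute z (U.E b a) := by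
  induction b, hab using Nat.le_induction with
  | base => exact hz a le_rfl (by omega)
  | succ b hb ih =>
    have i1 := ih (by omega) (fun i hi hi' => hz i hi (by omega))
    have i2 := hz b (by omega) (by omega)
    rw [U.lower_def (b+1) a b h1 hb (by omega) h4]
    exact (i2.mul_right i1).sub_right ((i1.mul_right i2).smul_right _)

theorem simple_commute (a b : ℕ) (ha : 1 ≤ a) (ha' : a + 1 ≤ m + n) (hb : 1 ≤ b)
    (hb' : b + 1 ≤ m + n) (hab : a ≠ b) : Commute (U.E a (a+1)) (U.E (b+1) b) := by
  have h := U.EF_rel a b ha ha' hb hb'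
  have hs : sgn m a (a+1) (b+1) b = 1 := by
    unfold sgn gr; split_ifs <;> first | omega | norm_num
  rw [if_neg hab, zero_smul, hs, one_smul, sub_eq_zero] at h
  exact h

/-- raising `E^a_b` and lowering `E^d_c` with disjoint supports commute -/
theorem disj_commute (a b c d : ℕ) (ha : 1 ≤ a) (hab : a < b) (hb : b ≤ m + n)
    (hc : 1 ≤ c) (hcd : c < d) (hd : d ≤ m + n) (h : b ≤ c ∨ d ≤ a) :
    Commute (U.E a b) (U.E d c) := by
  apply U.commute_lower _ c d hc hcd hd
  intro i hi hi'
  symm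
  apply U.commute_raise _ a b ha hab hb
  intro j hj hj'
  symm
  exact U.simple_commute j i (by omega) (by omega) (by omega) (by omega) (by omega)

theorem K_mul_aux (x y z : U.A) (p r : Fq) (h1 : x * y = p • (y * x)) (h2 : x * z = r • (z * x)) :
    x * (y * z) = (p * r) • (y * z * x) := by
  rw [← mul_assoc, h1, smul_mul_assoc, mul_assoc, h2, mul_smul_comm, smul_smul, mul_assoc]

theorem K_raise (i a b : ℕ) (hi : 1 ≤ i) (hi' : i ≤ m + n) (ha : 1 ≤ a) (hab : a < b)
    (hb : b ≤ m + n) :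
    U.K i * U.E a b = (qi m i ^ (δℤ i a - δℤ i b)) • (U.E a b * U.K i) := by
  induction b, hab using Nat.le_induction with
  | base => exact U.K_E_raise i a hi hi' ha hb
  | succ b hab ih =>
    have i1 := ih (by omega)
    have i2 := U.K_E_raise i b hi hi' (by omega) hb
    have e : qi m i ^ (δℤ i a - δℤ i b) * qi m i ^ (δℤ i b - δℤ i (b+1))
        = qi m i ^ (δℤ i a - δℤ i (b+1)) := by
      rw [← zpow_add₀ (qi_ne m i)]; congr 1; ring
    rw [U.raise_def a (b+1) b ha hab (by omega) hb, mul_sub, mul_smul_comm,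
      U.K_mul_aux _ _ _ _ _ i1 i2, U.K_mul_aux _ _ _ _ _ i2 i1,
      mul_comm (qi m i ^ (δℤ i b - δℤ i (b+1))), e, sub_mul, smul_mul_assoc, smul_sub, smul_comm (qi m i ^ _)]

theorem K_lower (i a b : ℕ) (hi : 1 ≤ i) (hi' : i ≤ m + n) (ha : 1 ≤ a) (hab : a < b)
    (hb : b ≤ m + n) :
    U.K i * U.E b a = (qi m i ^ (δℤ i b - δℤ i a)) • (U.E b a * U.K i) := by
  induction b, hab using Nat.le_induction with
  | base => exact U.K_E_lower i a hi hi' ha hb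
  | succ b hab ih =>
    have i1 := ih (by omega)
    have i2 := U.K_E_lower i b hi hi' (by omega) hb
    have e : qi m i ^ (δℤ i b - δℤ i a) * qi m i ^ (δℤ i (b+1) - δℤ i b)
        = qi m i ^ (δℤ i (b+1) - δℤ i a) := by
      rw [← zpow_add₀ (qi_ne m i)]; congr 1; ring
    rw [U.lower_def (b+1) a b ha hab (by omega) hb, mul_sub, mul_smul_comm,
      U.K_mul_aux _ _ _ _ _ i1 i2, U.K_mul_aux _ _ _ _ _ i2 i1,
      mul_comm (qi m i ^ (δℤ i (b+1) - δℤ i b)), e, sub_mul, smul_mul_assoc, smul_sub, smul_comm (qi m i ^ _)]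

theorem K_gen (i a b : ℕ) (hi : 1 ≤ i) (hi' : i ≤ m + n) (ha : 1 ≤ a) (ha' : a ≤ m + n)
    (hb : 1 ≤ b) (hb' : b ≤ m + n) (hab : a ≠ b) :
    U.K i * U.E a b = (qi m i ^ (δℤ i a - δℤ i b)) • (U.E a b * U.K i) := by
  rcases lt_or_gt_of_ne hab with h | h
  · exact U.K_raise i a b hi hi' ha h hb'
  · exact U.K_lower i b a hi hi' hb h ha'

theorem Kinv_gen (i a b : ℕ) (hi : 1 ≤ i) (hi' : i ≤ m + n) (ha : 1 ≤ a) (ha' : a ≤ m + n)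
    (hb : 1 ≤ b) (hb' : b ≤ m + n) (hab : a ≠ b) :
    U.Kinv i * U.E a b = (qi m i ^ (δℤ i a - δℤ i b))⁻¹ • (U.E a b * U.Kinv i) :=
  inv_scale_aux _ _ _ _ (zpow_ne_zero _ (qi_ne m i)) (U.K_Kinv i hi hi') (U.Kinv_K i hi hi')
    (U.K_gen i a b hi hi' ha ha' hb hb' hab)

theorem cKK (a b : ℕ) (ha : 1 ≤ a) (ha' : a ≤ m + n) (hb : 1 ≤ b) (hb' : b ≤ m + n) :
    Commute (U.K a) (U.K b) := U.K_comm a b ha ha' hb hb'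

theorem cIK (a b : ℕ) (ha : 1 ≤ a) (ha' : a ≤ m + n) (hb : 1 ≤ b) (hb' : b ≤ m + n) :
    Commute (U.Kinv a) (U.K b) :=
  commute_inv_aux _ _ _ (U.K_Kinv a ha ha') (U.Kinv_K a ha ha') (U.cKK a b ha ha' hb hb')

theorem cII (a b : ℕ) (ha : 1 ≤ a) (ha' : a ≤ m + n) (hb : 1 ≤ b) (hb' : b ≤ m + n) :
    Commute (U.Kinv a) (U.Kinv b) :=
  commute_inv_aux _ _ _ (U.K_Kinv a ha ha') (U.Kinv_K a ha ha')
    (U.cIK b a hb hb' ha ha').symm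

/-- `K_c K_b⁻¹` past `E x y`. -/
theorem KI_gen (c b x y : ℕ) (hc : 1 ≤ c) (hc' : c ≤ m + n) (hb : 1 ≤ b) (hb' : b ≤ m + n)
    (hx : 1 ≤ x) (hx' : x ≤ m + n) (hy : 1 ≤ y) (hy' : y ≤ m + n) (hxy : x ≠ y) :
    (U.K c * U.Kinv b) * U.E x y =
      (qi m c ^ (δℤ c x - δℤ c y) * (qi m b ^ (δℤ b x - δℤ b y))⁻¹) •
        (U.E x y * (U.K c * U.Kinv b)) := by
  rw [mul_assoc, U.Kinv_gen b x y hb hb' hx hx' hy hy' hxy, mul_smul_comm, ← mul_assoc,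
    U.K_gen c x y hc hc' hx hx' hy hy' hxy, smul_mul_assoc, smul_smul, mul_assoc, mul_comm (_⁻¹)]

theorem IK_gen (c b x y : ℕ) (hc : 1 ≤ c) (hc' : c ≤ m + n) (hb : 1 ≤ b) (hb' : b ≤ m + n)
    (hx : 1 ≤ x) (hx' : x ≤ m + n) (hy : 1 ≤ y) (hy' : y ≤ m + n) (hxy : x ≠ y) :
    (U.Kinv c * U.K b) * U.E x y =
      ((qi m c ^ (δℤ c x - δℤ c y))⁻¹ * qi m b ^ (δℤ b x - δℤ b y)) •
        (U.E x y * (U.Kinv c * U.K b)) := by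
  rw [mul_assoc, U.K_gen b x y hb hb' hx hx' hy hy' hxy, mul_smul_comm, ← mul_assoc,
    U.Kinv_gen c x y hc hc' hx hx' hy hy' hxy, smul_mul_assoc, smul_smul, mul_assoc,
    mul_comm (_⁻¹)]

/-- `[E^b_c, E^c_b]` property. -/
def PQ (c b : ℕ) : Prop :=
  U.E b c * U.E c b - sg m c b • (U.E c b * U.E b c)
    = (-sg m c b * (Δi m c)⁻¹) • (U.K c * U.Kinv b - U.Kinv c * U.K b)

/-- `[E^b_a, E^c_b]` for `a < c < b`, given the commutator `[E^b_c, E^c_b]`. -/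
theorem L2 (a c b : ℕ) (ha : 1 ≤ a) (hac : a < c) (hcb : c < b) (hb : b ≤ m + n)
    (h : U.PQ c b) :
    U.E b a * U.E c b - sg m c b • (U.E c b * U.E b a)
      = (-sg m c b) • (U.E c a * (U.Kinv c * U.K b)) := by
  have hR := (U.disj_commute c b a c (by omega) hcb hb ha hac (by omega) (by omega)).symm
  have k1 := U.KI_gen c b c a (by omega) (by omega) (by omega) (by omega) (by omega) (by omega)
    (by omega) (by omega) (by omega)
  have k2 := U.IK_gen c b c a (by omega) (by omega) (by omega) (by omega) (by omega) (by omega)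
    (by omega) (by omega) (by omega)
  simp only [δℤ, if_true, if_neg (show c ≠ a by omega), if_neg (show b ≠ c by omega),
    if_neg (show b ≠ a by omega), sub_zero, zpow_zero, zpow_one, inv_one, mul_one] at k1 k2
  have := abs_B _ _ _ _ _ _ _ _ hR.eq h k1 k2
  rw [← U.lower_def b a c ha hac hcb hb, qi_sub, inv_mul_cancel_right₀ (Δi_ne m c)] at this
  exact this

theorem PQ_all (c b : ℕ) (hc : 1 ≤ c) (hcb : c < b) (hb : b ≤ m + n) : U.PQ c b := by
  have base : ∀ e, 1 ≤ e → e + 1 ≤ m + n → U.PQ e (e+1) := by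
    intro e he he'
    have h := U.EF_rel e e he he' he he'
    rw [if_pos rfl] at h
    have hs : sgn m e (e+1) (e+1) e = sg m e (e+1) := by
      unfold sgn sg gr; split_ifs <;> norm_num
    rw [hs] at h
    unfold PQ
    rw [mul_smul, ← h, smul_sub, smul_smul, neg_mul, sg_sq]
    simp only [neg_smul, one_smul]
    abel
  induction b, hcb using Nat.le_induction with
  | base => exact base c hc hb
  | succ e hce ih =>
    have hce : c < e := hce
    have i1 : U.PQ c e := ih (by omega)
    have i2 := base e (by omega) hb
    have hWY := U.L2 c e (e+1) hc hce (by omega) hb i2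
    have hPX := (U.disj_commute c e e (e+1) hc hce (by omega) (by omega) (by omega) hb
      (by omega)).symm
    have k1 := U.KI_gen c e (e+1) e (by omega) (by omega) (by omega) (by omega) (by omega)
      (by omega) (by omega) (by omega) (by omega)
    have k2 := U.IK_gen c e (e+1) e (by omega) (by omega) (by omega) (by omega) (by omega)
      (by omega) (by omega) (by omega) (by omega)
    have k3 := U.KI_gen c e e (e+1) (by omega) (by omega) (by omega) (by omega) (by omega)
      (by omega) (by omega) (by omega) (by omega)
    have k4 := U.IK_gen e (e+1) c e (by omega) (by omega) (by omega) (by omega) (by omega)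
      (by omega) (by omega) (by omega) (by omega)
    simp only [δℤ, if_true, if_neg (show c ≠ e by omega), if_neg (show c ≠ e + 1 by omega),
      if_neg (show e ≠ e + 1 by omega), if_neg (show e + 1 ≠ e by omega),
      if_neg (show e ≠ c by omega), if_neg (show e + 1 ≠ c by omega),
      sub_zero, zero_sub, zpow_zero, zpow_one, inv_one, mul_one, one_mul, zpow_neg, inv_inv]
      at k1 k2 k3 k4
    have hWX := abs_A _ _ _ _ _ _ _ _ (qi_ne m e) hPX.eq i1 k1 k2
    rw [← U.lower_def (e+1) c e hc hce (by omega) hb] at hWX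
    have hI : Commute (U.Kinv e) (U.Kinv (e+1)) :=
      U.cII _ _ (by omega) (by omega) (by omega) (by omega)
    have hH : (U.K e * U.Kinv (e+1)) * (U.K c * U.Kinv e) = U.K c * U.Kinv (e+1) := by
      have c1 : Commute (U.K e * U.Kinv (e+1)) (U.K c) :=
        (U.cKK _ _ (by omega) (by omega) (by omega) (by omega)).mul_left
          (U.cIK _ _ (by omega) (by omega) (by omega) (by omega))
      rw [← mul_assoc, c1.eq, mul_assoc, mul_assoc, ← hI.eq, ← mul_assoc (U.K e),
        U.K_Kinv e (by omega) (by omega), one_mul]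
    have hH' : (U.Kinv c * U.K e) * (U.Kinv e * U.K (e+1)) = U.Kinv c * U.K (e+1) := by
      rw [mul_assoc, ← mul_assoc (U.K e), U.K_Kinv e (by omega) (by omega), one_mul]
    have hcm : Commute (U.Kinv e * U.K (e+1)) (U.K c * U.Kinv e) := by
      apply Commute.mul_left
      · exact (U.cIK _ _ (by omega) (by omega) (by omega) (by omega)).mul_right (Commute.refl _)
      · exact (U.cKK _ _ (by omega) (by omega) (by omega) (by omega)).mul_right
          (U.cIK _ _ (by omega) (by omega) (by omega) (by omega)).symm
    have := abs_step _ _ _ _ _ _ _ _ _ _ _ _ _ _ _ _ (qi_ne m e) (sg_sq m c e)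
      (sg_sq m e (e+1)) (Δi_ne m e) (qi_sub m e) hWX hWY i1 i2 k3 k4 hH hH' hcm.eq
    rw [← U.raise_def c (e+1) e hc hce (by omega) hb, sg_comp] at this
    exact this

end UqGl

theorem stmt17 (m n : ℕ) (hm : 1 ≤ m) (hn : 1 ≤ n) (U : UqGl m n)
    (a b c d : ℕ)
    (h1 : 1 ≤ a) (h2 : a ≤ m + n) (h3 : 1 ≤ b) (h4 : b ≤ m + n)
    (h5 : 1 ≤ c) (h6 : c ≤ m + n) (h7 : 1 ≤ d) (h8 : d ≤ m + n)
    (hac : a < c) (hcb : c < b) (hbd : b < d) :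
    U.br b a c d = (-Δi m c) • (U.E b d * U.E c a * U.Kinv c * U.K b) := by
  have hPQ := U.PQ_all c b h5 hcb h4
  have hWQ := U.L2 a c b h1 hac hcb h4 hPQ
  have hWY := (U.disj_commute b d a b h3 hbd h8 h1 (by omega) h4 (by omega)).symm
  have hRY := (U.disj_commute b d a c h3 hbd h8 h1 hac h6 (by omega)).symm
  have k := U.IK_gen c b b d h5 h6 h3 h4 h3 h4 h7 h8 (by omega)
  simp only [δℤ, if_true, if_neg (show c ≠ b by omega), if_neg (show c ≠ d by omega),
    if_neg (show b ≠ d by omega), sub_zero, zpow_zero, zpow_one, inv_one, one_mul] at k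
  have := abs_C _ _ _ _ _ _ _ _ hWY.eq hWQ k hRY.eq
  rw [← U.raise_def c d b h5 hcb hbd h8, qi_sub] at this
  have hs : sgn m b a c d = sg m c b := by
    unfold sgn sg gr; split_ifs <;> first | omega | norm_num
  have hd : -sg m c b * Δi m b = -Δi m c := by
    unfold sg Δi gr; split_ifs <;> norm_num
  rw [hd] at this
  unfold UqGl.br
  rw [hs, this]
  simp only [mul_assoc]


end
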